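/- arXiv:2401.13476 — 2 statements merged into one kernel-verified Lean document; each statement's English description precedes it below -/
import Mathlib

section
/- Let m, n ≥ 1, d = m + n, and let ψ : [1,∞) → (0,∞) be a decreasing function. Then for every T > 1, vol(E_{T,∞}) = π^d ∫_1^T ψ(t) dt. -/
open MeasureTheory NumberField Filter Topology
open scoped ENNReal NNReal

noncomputable section

/-- `‖x‖_∞ = max_i |x_i|²`: the supremum of the squared absolute values of the
coordinates (the normalized absolute value at a complex place). -/
def cnorm {k : Type*} [Fintype k] (x : k → ℂ) : ℝ := ⨆ i, Complex.normSq (x i)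

/-- The archimedean region
`E_{T,∞} = {(x,y) ∈ ℂ^m × ℂ^n : ‖x‖_∞^m ≤ ψ(‖y‖_∞^n), 1 ≤ ‖y‖_∞^n < T}`. -/
def Einf (m n : ℕ) (ψ : ℝ → ℝ) (T : ℝ) : Set ((Fin m → ℂ) × (Fin n → ℂ)) :=
  {z | cnorm z.1 ^ m ≤ ψ (cnorm z.2 ^ n) ∧ 1 ≤ cnorm z.2 ^ n ∧ cnorm z.2 ^ n < T}

theorem cnorm_nonneg {k : Type*} [Fintype k] (x : k → ℂ) : 0 ≤ cnorm x :=
  Real.iSup_nonneg fun i => Complex.normSq_nonneg (x i)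

theorem measurable_cnorm {k : Type*} [Fintype k] : Measurable (cnorm : (k → ℂ) → ℝ) :=
  Measurable.iSup fun i => Complex.continuous_normSq.measurable.comp (measurable_pi_apply i)

theorem measurable_cnorm_pow (k : ℕ) : Measurable fun x : Fin k → ℂ => cnorm x ^ k :=
  measurable_cnorm.pow_const k

theorem setOf_cnorm_le {k : Type*} [Fintype k] {s : ℝ} (hs : 0 ≤ s) :
    {x : k → ℂ | cnorm x ≤ s ^ 2} = Set.univ.pi fun _ => Metric.closedBall 0 s := by
  ext x
  simp only [Set.mem_ofPred_eq, Set.mem_univ_pi, mem_closedBall_zero_iff]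
  have key (i : k) : Complex.normSq (x i) ≤ s ^ 2 ↔ ‖x i‖ ≤ s := by
    rw [Complex.normSq_eq_norm_sq, sq_le_sq₀ (norm_nonneg _) hs]
  refine ⟨fun h i => (key i).1 ((le_ciSup (Set.finite_range _).bddAbove i).trans h), fun h =>
    Real.iSup_le (fun i => (key i).2 (h i)) (sq_nonneg s)⟩

theorem volume_cnorm_pow_le {k : ℕ} (hk : 1 ≤ k) {r : ℝ} (hr : 0 ≤ r) :
    volume {x : Fin k → ℂ | cnorm x ^ k ≤ r} = ENNReal.ofReal (Real.pi ^ k * r) := by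
  obtain ⟨s, hs, rfl⟩ : ∃ s : ℝ, 0 ≤ s ∧ (s ^ 2) ^ k = r := by
    refine ⟨r ^ ((2 * k : ℕ) : ℝ)⁻¹, Real.rpow_nonneg hr _, ?_⟩
    rw [← pow_mul, Real.rpow_inv_natCast_pow hr (by lia)]
  have hset : {x : Fin k → ℂ | cnorm x ^ k ≤ (s ^ 2) ^ k} = {x | cnorm x ≤ s ^ 2} := by
    ext x
    exact pow_le_pow_iff_left₀ (cnorm_nonneg x) (sq_nonneg s) (by lia)
  rw [hset, setOf_cnorm_le hs, volume_pi_pi]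
  simp only [Complex.volume_closedBall, Finset.prod_const, Finset.card_univ, Fintype.card_fin]
  rw [← mul_pow, ENNReal.ofReal_pow (by positivity), mul_comm Real.pi,
    ENNReal.ofReal_mul (by positivity), ENNReal.ofReal_pow hs, ← NNReal.coe_real_pi,
    ENNReal.ofReal_coe_nnreal]

/-- Up to any height `T`, the map `y ↦ ‖y‖_∞ ^ n` pushes Lebesgue measure on `ℂ ^ n` forward to
`π ^ n` times Lebesgue measure on `[0, ∞)`. -/
theorem map_cnorm_pow_restrict_Iic {n : ℕ} (hn : 1 ≤ n) (T : ℝ) :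
    (volume.map fun y : Fin n → ℂ => cnorm y ^ n).restrict (Set.Iic T) =
      (ENNReal.ofReal (Real.pi ^ n) • volume.restrict (Set.Ici 0)).restrict (Set.Iic T) := by
  have key (a : ℝ) : (volume.map fun y : Fin n → ℂ => cnorm y ^ n) (Set.Iic a) =
      ENNReal.ofReal (Real.pi ^ n * a) := by
    rw [Measure.map_apply (measurable_cnorm_pow n) measurableSet_Iic]
    rcases le_or_gt 0 a with ha | ha
    · exact volume_cnorm_pow_le hn ha
    · rw [ENNReal.ofReal_of_nonpos (mul_nonpos_of_nonneg_of_nonpos (by positivity) ha.le)]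
      refine measure_mono_null (fun y hy => ?_) measure_empty
      exact (ha.trans_le (pow_nonneg (cnorm_nonneg y) n)).not_ge hy
  have : IsFiniteMeasure
      ((volume.map fun y : Fin n → ℂ => cnorm y ^ n).restrict (Set.Iic T)) :=
    ⟨by rw [Measure.restrict_apply_univ, key]; exact ENNReal.ofReal_lt_top⟩
  refine Measure.ext_of_Iic _ _ fun a => ?_
  rw [Measure.restrict_apply measurableSet_Iic, Measure.restrict_apply measurableSet_Iic,
    Set.Iic_inter_Iic, key, Measure.smul_apply, Measure.restrict_apply measurableSet_Iic,
    Set.inter_comm, Set.Ici_inter_Iic, Real.volume_Icc, sub_zero, smul_eq_mul,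
    ENNReal.ofReal_mul (by positivity)]

theorem setLIntegral_cnorm_pow {n : ℕ} (hn : 1 ≤ n) {T : ℝ} {f : ℝ → ℝ≥0∞} (hf : Measurable f) :
    ∫⁻ y in (fun y : Fin n → ℂ => cnorm y ^ n) ⁻¹' Set.Ico 1 T, f (cnorm y ^ n) =
      ENNReal.ofReal (Real.pi ^ n) * ∫⁻ t in Set.Ico 1 T, f t := by
  have h := congrArg (fun μ : Measure ℝ => μ.restrict (Set.Ico 1 T))
    (map_cnorm_pow_restrict_Iic hn T)
  have hT : Set.Ico 1 T ⊆ Set.Iic T := fun t ht => ht.2.le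
  have h0 : Set.Ico 1 T ⊆ Set.Ici 0 := fun t ht => zero_le_one.trans ht.1
  simp only [Measure.restrict_smul, Measure.restrict_restrict measurableSet_Ico,
    Set.inter_eq_left.2 hT, Set.inter_eq_left.2 h0] at h
  rw [← setLIntegral_map measurableSet_Ico hf (measurable_cnorm_pow n), h,
    lintegral_smul_measure, smul_eq_mul]

/-- Equation (3.7) of the paper: `vol(E_{T,∞}) = π^d ∫_1^T ψ(t) dt`, where `vol` is
the standard `2d`-dimensional Lebesgue measure on `ℂ^d = ℂ^m × ℂ^n` and
`ψ : [1,∞) → (0,∞)` is decreasing. -/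
theorem volume_Einf (m n : ℕ) (hm : 1 ≤ m) (hn : 1 ≤ n) (ψ : ℝ → ℝ)
    (hψpos : ∀ t, 1 ≤ t → 0 < ψ t) (hψdec : AntitoneOn ψ (Set.Ici 1))
    (T : ℝ) (hT : 1 < T) :
    volume (Einf m n ψ T)
      = ENNReal.ofReal (Real.pi ^ (m + n) * ∫ t in (1:ℝ)..T, ψ t) := by
  have hφ : Measurable fun t => ψ (max 1 t) := Antitone.measurable fun a b hab =>
    hψdec (le_max_left 1 a) (le_max_left 1 b) (max_le_max_left 1 hab)
  have hE : Einf m n ψ T = {z | cnorm z.1 ^ m ≤ ψ (max 1 (cnorm z.2 ^ n))} ∩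
      {z | cnorm z.2 ^ n ∈ Set.Ico 1 T} := by
    ext z
    refine and_congr_left fun h => ?_
    rw [Set.mem_ofPred_eq, max_eq_right h.1]
  have hg : Measurable fun z : (Fin m → ℂ) × (Fin n → ℂ) => cnorm z.2 ^ n :=
    (measurable_cnorm_pow n).comp measurable_snd
  have hmeas : MeasurableSet (Einf m n ψ T) := by
    rw [hE]
    exact (measurableSet_le ((measurable_cnorm_pow m).comp measurable_fst) (hφ.comp hg)).inter
      (hg measurableSet_Ico)
  have hslice (y : Fin n → ℂ) : volume ((fun x => (x, y)) ⁻¹' Einf m n ψ T) =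
      ((fun y : Fin n → ℂ => cnorm y ^ n) ⁻¹' Set.Ico 1 T).indicator
        (fun y => ENNReal.ofReal (Real.pi ^ m * ψ (max 1 (cnorm y ^ n)))) y := by
    by_cases hy : y ∈ (fun y : Fin n → ℂ => cnorm y ^ n) ⁻¹' Set.Ico 1 T
    · rw [Set.indicator_of_mem hy, ← volume_cnorm_pow_le hm (hψpos _ (le_max_left _ _)).le, hE]
      congr 1
      ext x
      exact and_iff_left hy
    · rw [Set.indicator_of_notMem hy, hE]
      exact measure_mono_null (fun x hx => hy hx.2) measure_empty
  have hint : IntervalIntegrable ψ volume 1 T := AntitoneOn.intervalIntegrable <|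
    hψdec.mono <| by rw [Set.uIcc_of_le hT.le]; exact Set.Icc_subset_Ici_self
  rw [Measure.volume_eq_prod, Measure.prod_apply_symm hmeas]
  simp_rw [hslice]
  rw [lintegral_indicator (measurable_cnorm_pow n measurableSet_Ico),
    setLIntegral_cnorm_pow hn (f := fun t => ENNReal.ofReal (Real.pi ^ m * ψ (max 1 t)))
      (hφ.const_mul _).ennreal_ofReal,
    setLIntegral_congr_fun (g := fun t => ENNReal.ofReal (Real.pi ^ m * ψ t)) measurableSet_Ico
      (fun t ht => by simp only [max_eq_right ht.1]),
    setLIntegral_congr Ico_ae_eq_Ioc, ← ofReal_integral_eq_lintegral_ofReal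
      (hint.1.const_mul _) ?_, integral_const_mul, ← intervalIntegral.integral_of_le hT.le,
    ← ENNReal.ofReal_mul (by positivity), pow_add]
  · ring_nf
  · filter_upwards [ae_restrict_mem measurableSet_Ioc] with t ht
    exact mul_nonneg (by positivity) (hψpos t ht.1.le).le
end
end

section
/- Let m, n ≥ 1, d = m + n, and let ψ : [1,∞) → (0,∞) be a decreasing function. There exists 0 < c₀ < 1/2 such that for every ε ∈ (0, c₀) there is an open neighborhood H_ε ⊆ H of the identity such that for all h ∈ H_ε and all T > 10: E⁻_{T,ε,∞} ⊆ h·E_{T,∞} ⊆ E⁺_{T,ε,∞}, where h acts on ℂ^d by matrix multiplication. -/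
open MeasureTheory Filter Topology Matrix

noncomputable section

/-- `E_{T,∞} = {(x,y) ∈ ℂ^m × ℂ^n : ‖x‖_∞^m ≤ ψ(‖y‖_∞^n), 1 ≤ ‖y‖_∞^n < T}`,
realized inside `ℂ^d` with `d`-index set `Fin m ⊕ Fin n`. -/
def EinfS (m n : ℕ) (ψ : ℝ → ℝ) (T : ℝ) : Set ((Fin m ⊕ Fin n) → ℂ) :=
  {z | cnorm (fun i : Fin m => z (Sum.inl i)) ^ m
        ≤ ψ (cnorm (fun j : Fin n => z (Sum.inr j)) ^ n)
    ∧ 1 ≤ cnorm (fun j : Fin n => z (Sum.inr j)) ^ n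
    ∧ cnorm (fun j : Fin n => z (Sum.inr j)) ^ n < T}

/-- `E⁻_{T,ε,∞}`. -/
def EminusS (m n : ℕ) (ψ : ℝ → ℝ) (ε T : ℝ) : Set ((Fin m ⊕ Fin n) → ℂ) :=
  {z | cnorm (fun i : Fin m => z (Sum.inl i)) ^ m
        ≤ (1 + ε)⁻¹ * ψ ((1 + ε) * cnorm (fun j : Fin n => z (Sum.inr j)) ^ n)
    ∧ 3 / 2 ≤ cnorm (fun j : Fin n => z (Sum.inr j)) ^ n
    ∧ cnorm (fun j : Fin n => z (Sum.inr j)) ^ n < (1 + ε)⁻¹ * T}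

/-- `E′_{T,ε,∞}`. -/
def EprimeS (m n : ℕ) (ψ : ℝ → ℝ) (ε T : ℝ) : Set ((Fin m ⊕ Fin n) → ℂ) :=
  {z | cnorm (fun i : Fin m => z (Sum.inl i)) ^ m
        ≤ (1 + ε) * ψ ((1 + ε)⁻¹ * cnorm (fun j : Fin n => z (Sum.inr j)) ^ n)
    ∧ 3 / 2 ≤ cnorm (fun j : Fin n => z (Sum.inr j)) ^ n
    ∧ cnorm (fun j : Fin n => z (Sum.inr j)) ^ n ≤ (1 + ε) * T}

/-- `C₀ = {(x,y) : ‖x‖_∞^m ≤ 2ψ(1), 1/2 ≤ ‖y‖_∞^n ≤ 3/2}`. -/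
def CzeroS (m n : ℕ) (ψ : ℝ → ℝ) : Set ((Fin m ⊕ Fin n) → ℂ) :=
  {z | cnorm (fun i : Fin m => z (Sum.inl i)) ^ m ≤ 2 * ψ 1
    ∧ 1 / 2 ≤ cnorm (fun j : Fin n => z (Sum.inr j)) ^ n
    ∧ cnorm (fun j : Fin n => z (Sum.inr j)) ^ n ≤ 3 / 2}

/-- `E⁺_{T,ε,∞} = E′_{T,ε,∞} ∪ C₀`. -/
def EplusS (m n : ℕ) (ψ : ℝ → ℝ) (ε T : ℝ) : Set ((Fin m ⊕ Fin n) → ℂ) :=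
  EprimeS m n ψ ε T ∪ CzeroS m n ψ

/-- The subgroup `H ⊆ GL_d(ℂ)` of block lower triangular matrices `[[α, 0],[β, γ]]`
with `‖det α‖_∞ ‖det γ‖_∞ = 1`, i.e. elements of `GL_d(ℂ)` with vanishing upper-right
`m × n` block and `‖det‖_∞ = 1` (where `‖z‖_∞ = |z|²`). -/
def Hgrp (m n : ℕ) : Set (GL (Fin m ⊕ Fin n) ℂ) :=
  {h | (∀ (i : Fin m) (j : Fin n),
      (h : Matrix (Fin m ⊕ Fin n) (Fin m ⊕ Fin n) ℂ) (Sum.inl i) (Sum.inr j) = 0) ∧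
    Complex.normSq ((h : Matrix (Fin m ⊕ Fin n) (Fin m ⊕ Fin n) ℂ).det) = 1}

lemma cnorm_eq_norm_sq {k : Type*} [Fintype k] (x : k → ℂ) : cnorm x = ‖x‖ ^ 2 := by
  have hbdd : BddAbove (Set.range fun i => Complex.normSq (x i)) := (Set.finite_range _).bddAbove
  have h0 : 0 ≤ cnorm x := Real.iSup_nonneg fun i => Complex.normSq_nonneg _
  apply le_antisymm
  · refine Real.iSup_le (fun i => ?_) (sq_nonneg _)
    rw [Complex.normSq_eq_norm_sq]
    exact pow_le_pow_left₀ (norm_nonneg _) (norm_le_pi_norm x i) 2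
  · rw [← Real.le_sqrt (norm_nonneg _) h0, pi_norm_le_iff_of_nonneg (Real.sqrt_nonneg _)]
    intro i
    rw [Real.le_sqrt (norm_nonneg _) h0, ← Complex.normSq_eq_norm_sq]
    exact le_ciSup hbdd i

lemma norm_sum_mul_le {k : Type*} [Fintype k] {η : ℝ} (a x : k → ℂ)
    (ha : ∀ i, ‖a i‖ ≤ η) : ‖∑ i, a i * x i‖ ≤ Fintype.card k * (η * ‖x‖) := by
  calc ‖∑ i, a i * x i‖ ≤ ∑ _i : k, η * ‖x‖ := by
        refine norm_sum_le_of_le _ fun i _ => ?_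
        rw [norm_mul]
        exact mul_le_mul (ha i) (norm_le_pi_norm x i) (norm_nonneg _)
          ((norm_nonneg _).trans (ha i))
    _ = Fintype.card k * (η * ‖x‖) := by simp

section BlockEstimates

variable {m n : ℕ} {A : Matrix (Fin m ⊕ Fin n) (Fin m ⊕ Fin n) ℂ} {η δ : ℝ}

lemma norm_mulVec_sub_inl_le (hA : ∀ i j, ‖(A - 1) i j‖ ≤ η)
    (hzero : ∀ i j, A (Sum.inl i) (Sum.inr j) = 0) (hδ : 0 ≤ δ) (hη : m * η ≤ δ)
    (z : Fin m ⊕ Fin n → ℂ) :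
    ‖(fun i => (A *ᵥ z) (Sum.inl i)) - fun i => z (Sum.inl i)‖
      ≤ δ * ‖fun i => z (Sum.inl i)‖ := by
  rw [pi_norm_le_iff_of_nonneg (by positivity)]
  intro i
  have hsub : (A *ᵥ z) (Sum.inl i) - z (Sum.inl i)
      = ∑ j, (A - 1) (Sum.inl i) (Sum.inl j) * z (Sum.inl j) := by
    have h1 : (A *ᵥ z) (Sum.inl i) - z (Sum.inl i) = ((A - 1) *ᵥ z) (Sum.inl i) := by
      simp [Matrix.sub_mulVec]
    rw [h1, Matrix.mulVec, dotProduct, Fintype.sum_sum_type]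
    simp [hzero, Matrix.one_apply]
  rw [Pi.sub_apply, hsub]
  refine (norm_sum_mul_le _ (fun j => z (Sum.inl j)) fun j => hA _ _).trans ?_
  rw [Fintype.card_fin, ← mul_assoc]
  exact mul_le_mul_of_nonneg_right hη (norm_nonneg _)

lemma norm_mulVec_sub_inr_le (hA : ∀ i j, ‖(A - 1) i j‖ ≤ η)
    (hδ : 0 ≤ δ) (hηm : m * η ≤ δ) (hηn : n * η ≤ δ) (z : Fin m ⊕ Fin n → ℂ) :
    ‖(fun j => (A *ᵥ z) (Sum.inr j)) - fun j => z (Sum.inr j)‖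
      ≤ δ * (‖fun i => z (Sum.inl i)‖ + ‖fun j => z (Sum.inr j)‖) := by
  rw [pi_norm_le_iff_of_nonneg (by positivity)]
  intro i
  have hsub : (A *ᵥ z) (Sum.inr i) - z (Sum.inr i)
      = ∑ j, (A - 1) (Sum.inr i) (Sum.inl j) * z (Sum.inl j)
        + ∑ j, (A - 1) (Sum.inr i) (Sum.inr j) * z (Sum.inr j) := by
    have h1 : (A *ᵥ z) (Sum.inr i) - z (Sum.inr i) = ((A - 1) *ᵥ z) (Sum.inr i) := by
      simp [Matrix.sub_mulVec]
    rw [h1, Matrix.mulVec, dotProduct, Fintype.sum_sum_type]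
  rw [Pi.sub_apply, hsub, mul_add]
  refine (norm_add_le _ _).trans (add_le_add ?_ ?_)
  · refine (norm_sum_mul_le _ (fun j => z (Sum.inl j)) fun j => hA _ _).trans ?_
    rw [Fintype.card_fin, ← mul_assoc]
    exact mul_le_mul_of_nonneg_right hηm (norm_nonneg _)
  · refine (norm_sum_mul_le _ (fun j => z (Sum.inr j)) fun j => hA _ _).trans ?_
    rw [Fintype.card_fin, ← mul_assoc]
    exact mul_le_mul_of_nonneg_right hηn (norm_nonneg _)

end BlockEstimates

lemma le_mul_and_le_mul_of_norm_sub_le {E : Type*} [SeminormedAddCommGroup E] {u v : E} {D θ : ℝ}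
    (hD : D ≤ 1 / 2) (hDθ : 2 * D ≤ θ) (hD0 : 0 ≤ D) (h : ‖u - v‖ ≤ D * ‖v‖) :
    ‖u‖ ≤ (1 + θ) * ‖v‖ ∧ ‖v‖ ≤ (1 + θ) * ‖u‖ := by
  have h1 := norm_sub_norm_le u v
  have h2 := norm_sub_norm_le v u
  rw [norm_sub_rev] at h2
  have hu := norm_nonneg u
  have hv := norm_nonneg v
  constructor
  · nlinarith
  · have h3 : (1 - D) * ‖v‖ ≤ ‖u‖ := by linarith
    have h4 : ‖v‖ ≤ (1 + 2 * D) * ((1 - D) * ‖v‖) := by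
      nlinarith [mul_nonneg (mul_nonneg hD0 (by linarith : 0 ≤ 1 - 2 * D)) hv]
    calc ‖v‖ ≤ (1 + 2 * D) * ((1 - D) * ‖v‖) := h4
      _ ≤ (1 + θ) * ‖u‖ :=
        mul_le_mul (by linarith) h3 (mul_nonneg (by linarith) hv) (by linarith)

/-- A block lower triangular matrix close to the identity distorts the norms of both blocks of `z`
by a factor at most `1 + θ`, as soon as the first block of `z`, or of its image, is bounded by `R`
times the norm of the second one. -/
lemma exists_norm_mulVec_distortion (m n : ℕ) {R θ : ℝ} (hR : 0 ≤ R) (hθ : 0 < θ) :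
    ∃ η > 0, ∀ A : Matrix (Fin m ⊕ Fin n) (Fin m ⊕ Fin n) ℂ,
      (∀ i j, ‖(A - 1) i j‖ < η) → (∀ i j, A (Sum.inl i) (Sum.inr j) = 0) →
      ∀ z : Fin m ⊕ Fin n → ℂ,
        ‖fun i => z (Sum.inl i)‖ ≤ R * ‖fun j => z (Sum.inr j)‖ ∨
          ‖fun i => (A *ᵥ z) (Sum.inl i)‖ ≤ R * ‖fun j => (A *ᵥ z) (Sum.inr j)‖ →
        (‖fun i => (A *ᵥ z) (Sum.inl i)‖ ≤ (1 + θ) * ‖fun i => z (Sum.inl i)‖ ∧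
          ‖fun i => z (Sum.inl i)‖ ≤ (1 + θ) * ‖fun i => (A *ᵥ z) (Sum.inl i)‖) ∧
        (‖fun j => (A *ᵥ z) (Sum.inr j)‖ ≤ (1 + θ) * ‖fun j => z (Sum.inr j)‖ ∧
          ‖fun j => z (Sum.inr j)‖ ≤ (1 + θ) * ‖fun j => (A *ᵥ z) (Sum.inr j)‖) := by
  obtain ⟨μ, hμ0, hμ1, hμθ⟩ : ∃ μ : ℝ, 0 < μ ∧ μ ≤ 1 / 2 ∧ 2 * μ ≤ θ :=
    ⟨min (1 / 2) (θ / 2), by positivity, min_le_left _ _,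
      by linarith [min_le_right (1 / 2) (θ / 2)]⟩
  obtain ⟨δ, hδ0, hδ⟩ : ∃ δ : ℝ, 0 < δ ∧ δ * (1 + 8 * R) = μ :=
    ⟨μ / (1 + 8 * R), by positivity, by field_simp⟩
  have hδR : 0 ≤ δ * R := by positivity
  have hδμ : δ ≤ μ := by nlinarith
  obtain ⟨η, hη0, hηm, hηn⟩ : ∃ η : ℝ, 0 < η ∧ m * η ≤ δ ∧ n * η ≤ δ := by
    refine ⟨δ / (m + n + 1), by positivity, ?_, ?_⟩
    · rw [mul_div_assoc', div_le_iff₀ (by positivity)]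
      nlinarith [mul_nonneg hδ0.le (Nat.cast_nonneg (α := ℝ) n)]
    · rw [mul_div_assoc', div_le_iff₀ (by positivity)]
      nlinarith [mul_nonneg hδ0.le (Nat.cast_nonneg (α := ℝ) m)]
  refine ⟨η, hη0, fun A hA hzero z hz => ?_⟩
  have hx := norm_mulVec_sub_inl_le (fun i j => (hA i j).le) hzero hδ0.le hηm z
  have hy := norm_mulVec_sub_inr_le (fun i j => (hA i j).le) hδ0.le hηm hηn z
  set x := fun i => z (Sum.inl i)
  set y := fun j => z (Sum.inr j)
  set x' := fun i => (A *ᵥ z) (Sum.inl i)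
  set y' := fun j => (A *ᵥ z) (Sum.inr j)
  refine ⟨le_mul_and_le_mul_of_norm_sub_le (by linarith) (by linarith) hδ0.le hx, ?_⟩
  have hxy : ‖x‖ ≤ 8 * R * ‖y‖ := by
    rcases hz with hz | hz
    · nlinarith [mul_nonneg hR (norm_nonneg y)]
    · have hxx' := (le_mul_and_le_mul_of_norm_sub_le (θ := 1) (by linarith) (by linarith)
        hδ0.le hx).2
      have hx2 : ‖x‖ ≤ 2 * R * ‖y'‖ := by linarith
      have hy' := norm_sub_norm_le y' y
      have h1 : δ * ‖x‖ ≤ 2 * (δ * R) * ‖y'‖ := by nlinarith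
      have h2 : 2 * (δ * R) * ‖y'‖ ≤ 1 / 2 * ‖y'‖ :=
        mul_le_mul_of_nonneg_right (by linarith) (norm_nonneg _)
      have h3 : δ * ‖y‖ ≤ 1 * ‖y‖ := mul_le_mul_of_nonneg_right (by linarith) (norm_nonneg _)
      have h4 : ‖y'‖ ≤ 4 * ‖y‖ := by linarith
      nlinarith
  refine le_mul_and_le_mul_of_norm_sub_le hμ1 hμθ hμ0.le (hy.trans ?_)
  rw [← hδ, mul_assoc]
  exact mul_le_mul_of_nonneg_left (by linarith) hδ0.le

lemma exists_one_add_pow_le (m n : ℕ) {ε : ℝ} (hε : 0 < ε) :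
    ∃ θ > 0, ((1 + θ) ^ 2) ^ m ≤ 1 + ε ∧ ((1 + θ) ^ 2) ^ n ≤ 1 + ε := by
  have key : ∀ k : ℕ, ∀ᶠ θ : ℝ in 𝓝 0, ((1 + θ) ^ 2) ^ k ≤ 1 + ε := fun k => by
    have hc : ContinuousAt (fun θ : ℝ => ((1 + θ) ^ 2) ^ k) 0 := by fun_prop
    exact hc.eventually_le_const (by simpa using hε)
  obtain ⟨θ, ⟨h1, h2⟩, h3⟩ :=
    ((((key m).and (key n)).filter_mono nhdsWithin_le_nhds).and
      (self_mem_nhdsWithin (s := Set.Ioi (0 : ℝ)))).exists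
  exact ⟨θ, h3, h1, h2⟩

lemma cnorm_pow_le_of_norm_le {k : Type*} [Fintype k] {u v : k → ℂ} {θ c : ℝ} {p : ℕ}
    (hc : ((1 + θ) ^ 2) ^ p ≤ c) (h : ‖u‖ ≤ (1 + θ) * ‖v‖) :
    cnorm u ^ p ≤ c * cnorm v ^ p := by
  rw [cnorm_eq_norm_sq, cnorm_eq_norm_sq]
  calc (‖u‖ ^ 2) ^ p ≤ (((1 + θ) * ‖v‖) ^ 2) ^ p := by gcongr
    _ = ((1 + θ) ^ 2) ^ p * (‖v‖ ^ 2) ^ p := by rw [mul_pow, mul_pow]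
    _ ≤ c * (‖v‖ ^ 2) ^ p := by gcongr

lemma norm_le_one_add_of_cnorm_pow_le {k : Type*} [Fintype k] {u : k → ℂ} {c : ℝ} {p : ℕ}
    (hp : 1 ≤ p) (hc : 0 ≤ c) (h : cnorm u ^ p ≤ c) : ‖u‖ ≤ 1 + c := by
  by_contra! hlt
  have hu : 1 ≤ ‖u‖ := by linarith
  rw [cnorm_eq_norm_sq, ← pow_mul] at h
  linarith [le_self_pow₀ hu (by omega : 2 * p ≠ 0)]

lemma one_le_norm_of_one_le_cnorm_pow {k : Type*} [Fintype k] {u : k → ℂ} {p : ℕ}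
    (hp : 1 ≤ p) (h : 1 ≤ cnorm u ^ p) : 1 ≤ ‖u‖ := by
  rw [cnorm_eq_norm_sq, ← pow_mul] at h
  exact (one_le_pow_iff_of_nonneg (norm_nonneg _) (by omega)).1 h

lemma isOpen_setOf_norm_val_sub_one_lt {ι : Type*} [Fintype ι] [DecidableEq ι] (η : ℝ) :
    IsOpen {h : GL ι ℂ | ∀ i j, ‖((h : Matrix ι ι ℂ) - 1) i j‖ < η} := by
  simp only [Set.ofPred_forall]
  refine isOpen_iInter_of_finite fun i => isOpen_iInter_of_finite fun j => ?_
  have hc : Continuous fun h : GL ι ℂ => ((h : Matrix ι ι ℂ) - 1) i j :=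
    (Units.continuous_val.sub continuous_const).matrix_elem i j
  exact isOpen_lt hc.norm continuous_const

/-- Lemma 3.6 of the paper (the squeezing lemma, generalizing Lemma 3.1 of
Alam–Ghosh–Yu): there is `0 < c₀ < 1/2` such that for each `ε ∈ (0, c₀)` there is a
relatively open neighborhood `H_ε = V ∩ H` of the identity in `H` such that
`E⁻_{T,ε,∞} ⊆ h E_{T,∞} ⊆ E⁺_{T,ε,∞}` for all `h ∈ H_ε` and all `T > 10`. -/
theorem squeeze_E_sets (m n : ℕ) (hm : 1 ≤ m) (hn : 1 ≤ n)
    (ψ : ℝ → ℝ) (hψpos : ∀ t, 1 ≤ t → 0 < ψ t) (hψdec : AntitoneOn ψ (Set.Ici 1)) :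
    ∃ c₀ : ℝ, 0 < c₀ ∧ c₀ < 1 / 2 ∧
      ∀ ε : ℝ, 0 < ε → ε < c₀ →
        ∃ V : Set (GL (Fin m ⊕ Fin n) ℂ), IsOpen V ∧ 1 ∈ V ∧
          ∀ h ∈ V, h ∈ Hgrp m n → ∀ T : ℝ, 10 < T →
            EminusS m n ψ ε T
                ⊆ (fun z => (Units.val h).mulVec z) '' EinfS m n ψ T ∧
            (fun z => (Units.val h).mulVec z) '' EinfS m n ψ T
                ⊆ EplusS m n ψ ε T := by
  refine ⟨1 / 4, by norm_num, by norm_num, fun ε hε hε4 => ?_⟩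
  have hψ1 := hψpos 1 le_rfl
  obtain ⟨θ, hθ, hθm, hθn⟩ := exists_one_add_pow_le m n hε
  obtain ⟨η, hη, hdist⟩ :=
    exists_norm_mulVec_distortion m n (R := 1 + ψ 1) (by linarith) hθ
  have hcnorm_le : ∀ {u : Fin m → ℂ} {v : Fin n → ℂ}, cnorm u ^ m ≤ ψ 1 → 1 ≤ cnorm v ^ n →
      ‖u‖ ≤ (1 + ψ 1) * ‖v‖ := fun hu hv =>
    (norm_le_one_add_of_cnorm_pow_le hm hψ1.le hu).trans
      (le_mul_of_one_le_right (by linarith) (one_le_norm_of_one_le_cnorm_pow hn hv))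
  have hinv_le : ∀ {a b : ℝ}, a ≤ (1 + ε) * b → (1 + ε)⁻¹ * a ≤ b := fun h =>
    (inv_mul_le_iff₀ (by linarith)).2 h
  refine ⟨_, isOpen_setOf_norm_val_sub_one_lt η, by simp [hη], ?_⟩
  rintro h hV ⟨hzero, -⟩ T -
  have hdist := hdist h hV hzero
  constructor
  · rintro w ⟨hwx, hwy, hwT⟩
    obtain ⟨z, rfl⟩ : ∃ z, (h : Matrix (Fin m ⊕ Fin n) (Fin m ⊕ Fin n) ℂ) *ᵥ z = w :=
      ⟨(h⁻¹ : GL (Fin m ⊕ Fin n) ℂ).val *ᵥ w, by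
        rw [Matrix.mulVec_mulVec, ← Units.val_mul, mul_inv_cancel, Units.val_one,
          Matrix.one_mulVec]⟩
    refine ⟨z, ?_, rfl⟩
    have hwx' := (le_inv_mul_iff₀ (by linarith)).1 hwx
    have hmem : (1 : ℝ) ≤ (1 + ε) * cnorm (fun j : Fin n => (h.val *ᵥ z) (Sum.inr j)) ^ n := by
      nlinarith
    have hwψ : cnorm (fun i : Fin m => (h.val *ᵥ z) (Sum.inl i)) ^ m ≤ ψ 1 := by
      have h1 := hψdec (Set.mem_Ici.2 le_rfl) hmem hmem
      have h2 := mul_nonneg hε.le (pow_nonneg (Real.iSup_nonneg fun i : Fin m =>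
        Complex.normSq_nonneg ((h.val *ᵥ z) (Sum.inl i))) m)
      change 0 ≤ ε * cnorm _ ^ m at h2
      linarith
    obtain ⟨⟨-, hx⟩, hy, hy'⟩ := hdist z (.inr (hcnorm_le hwψ (by linarith)))
    have hx := cnorm_pow_le_of_norm_le hθm hx
    have hy := cnorm_pow_le_of_norm_le hθn hy
    have hy' := cnorm_pow_le_of_norm_le hθn hy'
    have hz1 : 1 ≤ cnorm (fun j : Fin n => z (Sum.inr j)) ^ n := by nlinarith
    exact ⟨hx.trans (hwx'.trans (hψdec hz1 hmem hy')), hz1,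
      hy'.trans_lt ((lt_inv_mul_iff₀ (by linarith)).1 hwT)⟩
  · rintro _ ⟨z, ⟨hzx, hzy, hzT⟩, rfl⟩
    obtain ⟨⟨hx, -⟩, hy, hy'⟩ := hdist z
      (.inl (hcnorm_le (hzx.trans (hψdec (Set.mem_Ici.2 le_rfl) hzy hzy)) hzy))
    have hx := cnorm_pow_le_of_norm_le hθm hx
    have hy := cnorm_pow_le_of_norm_le hθn hy
    have hy' := cnorm_pow_le_of_norm_le hθn hy'
    rcases le_total (3 / 2) (cnorm (fun j : Fin n => (h.val *ᵥ z) (Sum.inr j)) ^ n) with hw | hw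
    · left
      refine ⟨hx.trans ?_, hw, hy.trans (by gcongr)⟩
      refine mul_le_mul_of_nonneg_left (hzx.trans (hψdec ?_ hzy (hinv_le hy))) (by linarith)
      rw [Set.mem_Ici, inv_mul_eq_div, le_div_iff₀ (by linarith)]
      linarith
    · right
      refine ⟨hx.trans ?_, ?_, hw⟩
      · have := hzx.trans (hψdec (Set.mem_Ici.2 le_rfl) hzy hzy)
        nlinarith
      · nlinarith
end
end
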